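/- Let G be a connected graph and v a vertex adjacent to two distinct degree-one vertices u and w. Then G has a geodetic set of size at most k if and only if G - u has a geodetic set of size at most k - 1. -/

import Mathlib

/-- A set `S` is geodetic if every vertex lies on a shortest path between two
vertices of `S`. -/
def IsGeodeticSet {V : Type*} (G : SimpleGraph V) (S : Set V) : Prop :=
  ∀ w : V, ∃ u ∈ S, ∃ v ∈ S, G.dist u v = G.dist u w + G.dist w v

namespace SimpleGraph

variable {V W : Type*} {G : SimpleGraph V} {H : SimpleGraph W}

/-- A graph homomorphism does not increase distances between reachable vertices. -/
theorem Reachable.dist_map_le {a b : V} (h : G.Reachable a b) (f : G →g H) :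
    H.dist (f a) (f b) ≤ G.dist a b := by
  obtain ⟨p, hp⟩ := h.exists_walk_length_eq_dist
  rw [← hp, ← Walk.length_map f p]
  exact dist_le _

/-- If every neighbour of `u` is `v`, every vertex other than `u` is one step closer to `v`. -/
theorem Connected.dist_leaf (hG : G.Connected) {u v y : V} (huv : G.Adj v u)
    (hleaf : ∀ x, G.Adj u x → x = v) (hy : y ≠ u) : G.dist u y = 1 + G.dist v y := by
  apply le_antisymm
  · have h := hG.dist_triangle (u := u) (v := v) (w := y)
    rwa [dist_eq_one_iff_adj.2 huv.symm] at h
  · obtain ⟨p, hp⟩ := hG.exists_walk_length_eq_dist u y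
    cases p with
    | nil => exact absurd rfl hy
    | cons h q =>
      obtain rfl := hleaf _ h
      have := dist_le q
      rw [Walk.length_cons] at hp
      omega

/-- Folding a vertex `u` onto a vertex `w` adjacent to all neighbours of `u`. -/
noncomputable def foldHom (u w : V) (huw : u ≠ w) (h : ∀ x, G.Adj u x → G.Adj w x) :
    G →g G.induce ({u}ᶜ : Set V) := by
  classical
  exact
  { toFun := fun x => if hx : x = u then ⟨w, huw.symm⟩ else ⟨x, hx⟩
    map_rel' := by
      intro a b hab
      by_cases ha : a = u <;> by_cases hb : b = u
      · subst ha hb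
        exact absurd hab (G.loopless.irrefl _)
      · subst ha
        simpa [hb] using h b hab
      · subst hb
        simpa [ha] using (h a hab.symm).symm
      · simpa [ha, hb] using hab }

theorem foldHom_apply_coe {u w : V} (huw : u ≠ w) (h : ∀ x, G.Adj u x → G.Adj w x)
    (a : ({u}ᶜ : Set V)) : foldHom u w huw h a = a := by
  have ha : (a : V) ≠ u := a.2
  simp [foldHom, ha]

/-- Deleting a vertex whose neighbourhood is contained in that of another vertex
preserves distances. -/
theorem Connected.dist_induce_compl_singleton (hG : G.Connected) {u w : V} (huw : u ≠ w)
    (h : ∀ x, G.Adj u x → G.Adj w x) (a b : ({u}ᶜ : Set V)) :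
    (G.induce ({u}ᶜ : Set V)).dist a b = G.dist a b := by
  apply le_antisymm
  · simpa only [foldHom_apply_coe] using (hG a b).dist_map_le (foldHom u w huw h)
  · have hr : (G.induce ({u}ᶜ : Set V)).Reachable a b := by
      simpa only [foldHom_apply_coe] using (hG a b).map (foldHom u w huw h)
    exact hr.dist_map_le (Embedding.induce ({u}ᶜ : Set V)).toHom

end SimpleGraph

/-- Every geodetic set contains all leaves. -/
theorem IsGeodeticSet.leaf_mem {V : Type*} {G : SimpleGraph V} {S : Set V}
    (hS : IsGeodeticSet G S) (hG : G.Connected) {u v : V} (huv : G.Adj v u)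
    (hleaf : ∀ x, G.Adj u x → x = v) : u ∈ S := by
  obtain ⟨a, ha, b, hb, hab⟩ := hS u
  by_contra hu
  have hau := hG.dist_leaf huv hleaf (y := a) (by rintro rfl; exact hu ha)
  have hbu := hG.dist_leaf huv hleaf (y := b) (by rintro rfl; exact hu hb)
  have := hG.dist_triangle (u := a) (v := v) (w := b)
  rw [G.dist_comm (u := a) (v := u)] at hab
  rw [G.dist_comm (u := a) (v := v)] at this
  omega

/-- Deleting one of two twin leaves from a geodetic set leaves a set that still covers every
other vertex. -/
theorem IsGeodeticSet.exists_ne_twin_leaf {V : Type*} [Fintype V] [DecidableEq V]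
    {G : SimpleGraph V} {S : Set V} (hS : IsGeodeticSet G S) (hG : G.Connected)
    (hcard : 4 ≤ Fintype.card V) {u v w : V} (huw : u ≠ w) (hu : G.Adj v u) (hw : G.Adj v w)
    (hlu : ∀ x, G.Adj u x → x = v) (hlw : ∀ x, G.Adj w x → x = v) {x : V} (hx : x ≠ u) :
    ∃ a ∈ S, a ≠ u ∧ ∃ b ∈ S, b ≠ u ∧ G.dist a b = G.dist a x + G.dist x b := by
  have hwS : w ∈ S := hS.leaf_mem hG hw hlw
  have hself : ∀ y ∈ S, y ≠ u → y = x →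
      ∃ a ∈ S, a ≠ u ∧ ∃ b ∈ S, b ≠ u ∧ G.dist a b = G.dist a x + G.dist x b := by
    rintro y hy hyu rfl
    exact ⟨y, hy, hyu, y, hy, hyu, by simp⟩
  by_cases hxw : x = w
  · exact hself w hwS huw.symm hxw.symm
  have hdu : ∀ y, y ≠ u → G.dist u y = 1 + G.dist v y := fun y => hG.dist_leaf hu hlu
  have hdw : ∀ y, y ≠ w → G.dist w y = 1 + G.dist v y := fun y => hG.dist_leaf hw hlw
  have hvw : G.dist v w = 1 := SimpleGraph.dist_eq_one_iff_adj.2 hw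
  have hsmall : ∀ y, y ≠ u → y ≠ w → G.dist u w = G.dist u y + G.dist y w → y = v := by
    intro y hyu hyw h
    rw [hdu w huw.symm, hdu y hyu, G.dist_comm (u := y), hdw y hyw] at h
    exact (hG.dist_eq_zero_iff.1 (by omega : G.dist v y = 0)).symm
  have key : ∀ b ∈ S, G.dist u b = G.dist u x + G.dist x b →
      ∃ a ∈ S, a ≠ u ∧ ∃ b ∈ S, b ≠ u ∧ G.dist a b = G.dist a x + G.dist x b := by
    intro b hb h
    by_cases hbu : b = u
    · subst hbu
      rw [SimpleGraph.dist_self] at h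
      exact absurd (hG.dist_eq_zero_iff.1 (by omega : G.dist x b = 0)) hx
    by_cases hbw : b = w
    · subst hbw
      obtain rfl := hsmall x hx hxw h
      obtain ⟨s, hs, hsu, hsb⟩ : ∃ s ∈ S, s ≠ u ∧ s ≠ b := by
        by_contra! hcon
        obtain ⟨z, hz⟩ : ∃ z, z ∉ ({u, x, b} : Finset V) := by
          by_contra! hall
          have h1 := Finset.card_le_three (a := u) (b := x) (c := b)
          rw [Finset.eq_univ_iff_forall.2 hall, Finset.card_univ] at h1
          omega
        simp only [Finset.mem_insert, Finset.mem_singleton, not_or] at hz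
        obtain ⟨hzu, hzx, hzb⟩ := hz
        have hmem : ∀ s ∈ S, s = u ∨ s = b := fun s hs => or_iff_not_imp_left.2 (hcon s hs)
        have hne : ∀ y, z ≠ y → G.dist y y ≠ G.dist y z + G.dist z y := by
          intro y hy h'
          rw [SimpleGraph.dist_self] at h'
          exact hy (hG.dist_eq_zero_iff.1 (by omega : G.dist z y = 0))
        obtain ⟨c, hc, d, hd, hcd⟩ := hS z
        rcases hmem c hc with rfl | rfl <;> rcases hmem d hd with rfl | rfl
        · exact hne _ hzu hcd
        · exact hzx (hsmall z hzu hzb hcd)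
        · refine hzx (hsmall z hzu hzb ?_)
          rw [G.dist_comm, hcd, G.dist_comm (u := c), G.dist_comm (u := z) (v := d), add_comm]
        · exact hne _ hzb hcd
      refine ⟨b, hb, hbu, s, hs, hsu, ?_⟩
      rw [hdw s hsb, G.dist_comm (u := b), hvw]
    · refine ⟨w, hwS, huw.symm, b, hb, hbu, ?_⟩
      rw [hdu b hbu, hdu x hx] at h
      rw [hdw b hbw, hdw x hxw, h]
  obtain ⟨a, ha, b, hb, hab⟩ := hS x
  by_cases hau : a = u
  · exact key b hb (hau ▸ hab)
  by_cases hbu : b = u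
  · refine key a ha ?_
    rw [← hbu, G.dist_comm, hab, G.dist_comm (u := a), G.dist_comm (u := b), add_comm]
  exact ⟨a, ha, hau, b, hb, hbu, hab⟩

/-- if `v` is adjacent to two distinct degree-one vertices `u, w`,
then `G` has a geodetic set of size at most `k` iff `G - u` has one of size at
most `k - 1`. -/
theorem geodetic_del_twin_leaf {V : Type*} [Fintype V] [DecidableEq V]
    (G : SimpleGraph V) [DecidableRel G.Adj] (hG : G.Connected)
    (hcard : 4 ≤ Fintype.card V)
    (u v w : V) (huw : u ≠ w) (hu : G.Adj v u) (hw : G.Adj v w)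
    (hdu : G.degree u = 1) (hdw : G.degree w = 1) (k : ℕ) :
    (∃ S : Set V, IsGeodeticSet G S ∧ S.ncard ≤ k) ↔
      (∃ S : Set ({u}ᶜ : Set V), IsGeodeticSet (G.induce ({u}ᶜ : Set V)) S ∧
        S.ncard ≤ k - 1) := by
  have leaf : ∀ y, G.Adj v y → G.degree y = 1 → ∀ x, G.Adj y x → x = v := by
    intro y hy hd x hx
    obtain ⟨z, -, hz⟩ := G.degree_eq_one_iff_existsUnique_adj.1 hd
    rw [hz x hx, hz v hy.symm]
  have hlu := leaf u hu hdu
  have hlw := leaf w hw hdw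
  have hdist := hG.dist_induce_compl_singleton huw
    (fun x hx => by rw [hlu x hx]; exact hw.symm)
  constructor
  · rintro ⟨S, hS, hk⟩
    refine ⟨Subtype.val ⁻¹' S, fun x => ?_, ?_⟩
    · obtain ⟨a, ha, hau, b, hb, hbu, h⟩ :=
        hS.exists_ne_twin_leaf hG hcard huw hu hw hlu hlw x.2
      exact ⟨⟨a, hau⟩, ha, ⟨b, hbu⟩, hb, by simpa only [hdist] using h⟩
    · have huS : u ∈ S := hS.leaf_mem hG hu hlu
      rw [← Set.ncard_image_of_injective _ Subtype.val_injective,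
        Subtype.image_preimage_coe, Set.inter_comm, ← Set.sdiff_eq,
        Set.ncard_sdiff_singleton_of_mem huS]
      omega
  · rintro ⟨S, hS, hk⟩
    refine ⟨insert u (Subtype.val '' S), fun x => ?_, ?_⟩
    · by_cases hx : x = u
      · exact ⟨u, by simp, u, by simp, by simp [hx]⟩
      · obtain ⟨a, ha, b, hb, h⟩ := hS ⟨x, hx⟩
        exact ⟨a, Or.inr ⟨a, ha, rfl⟩, b, Or.inr ⟨b, hb, rfl⟩, by simpa only [hdist] using h⟩
    · have hpos : 0 < S.ncard := by
        obtain ⟨a, ha, -⟩ := hS ⟨w, huw.symm⟩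
        exact (Set.ncard_pos S.toFinite).2 ⟨a, ha⟩
      have h1 := Set.ncard_insert_le u (Subtype.val '' S)
      rw [Set.ncard_image_of_injective _ Subtype.val_injective] at h1
      omega
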